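/- arXiv:1910.02616 — 2 statements merged into one kernel-verified Lean document; each statement's English description precedes it below -/
import Mathlib

section
/- Let k be an algebraically closed field, n ≥ 1, and R = k[x_0,…,x_n]. Let a_1 ≤ … ≤ a_l (with l ≥ 1) and b_1 ≤ … ≤ b_{l+r} (with r ≥ 1) be weakly increasing integer sequences. Then the following are equivalent: (i) there exists an (l+r)×l matrix M over R whose entry M_{j,i} (row j, column i) is homogeneous of degree a_i − b_j and is zero whenever a_i ≤ b_j, such that the ideal I_l(M) of l×l minors has height at least n+1; (ii) r ≥ n and a_i > b_{n+i} for all i = 1,…,l. -/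
/-- The ideal `I_q(M)` of maximal minors of a `p × q` matrix `M` (with `p ≥ q`):
the ideal generated by the determinants of all `q × q` submatrices. -/
def maxMinorsIdeal {S : Type*} [CommRing S] {p q : ℕ}
    (M : Matrix (Fin p) (Fin q) S) : Ideal S :=
  Ideal.span {x | ∃ f : Fin q → Fin p, Function.Injective f ∧ x = (M.submatrix f id).det}

/-- The height (codimension) of an ideal: the infimum of the heights of the prime ideals
containing it. -/
noncomputable def idealHeight {S : Type*} [CommRing S] (I : Ideal S) : ℕ∞ :=
  ⨅ (P : PrimeSpectrum S) (_ : I ≤ P.asIdeal), Order.height P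

/-- A matrix over `R` is degenerate at an ideal `Q` if some column vector not lying in `Q`
is sent into `Q`; for `Q` prime this says that the columns are linearly dependent over the
residue field of `Q`. -/
def IsDegenerateAt {R : Type*} [CommRing R] {p q : ℕ} (N : Matrix (Fin p) (Fin q) R)
    (Q : Ideal R) : Prop :=
  ∃ v : Fin q → R, (∃ j, v j ∉ Q) ∧ ∀ i, ∑ j, N i j * v j ∈ Q

theorem exists_submatrix_det_ne_zero {K : Type*} [Field K] {p q : ℕ}
    (N : Matrix (Fin p) (Fin q) K) (hN : ∀ v : Fin q → K, N.mulVec v = 0 → v = 0) :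
    ∃ f : Fin q → Fin p, Function.Injective f ∧ (N.submatrix f id).det ≠ 0 := by
  have hrank : N.rank = q := by
    have hinj : Function.Injective N.mulVecLin := by
      rw [← LinearMap.ker_eq_bot, LinearMap.ker_eq_bot']
      exact hN
    rw [Matrix.rank, LinearMap.finrank_range_of_inj hinj]
    simp
  rw [Matrix.rank_eq_finrank_span_row] at hrank
  have hspan := Submodule.exists_fun_fin_finrank_span_eq K (Set.range N.row)
  rw [hrank] at hspan
  obtain ⟨g, hg, -, hli⟩ := hspan
  choose f hf using hg
  have hrow : (N.submatrix f id).row = g := funext hf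
  refine ⟨f, fun x y hxy => hli.injective ?_, ?_⟩
  · rw [← hf x, ← hf y, hxy]
  · rw [← hrow, Matrix.linearIndependent_rows_iff_isUnit] at hli
    exact ((Matrix.isUnit_iff_isUnit_det _).1 hli).ne_zero

theorem maxMinorsIdeal_le_iff_isDegenerateAt {R : Type*} [CommRing R] {p q : ℕ}
    (N : Matrix (Fin p) (Fin q) R) (Q : Ideal R) [Q.IsPrime] :
    maxMinorsIdeal N ≤ Q ↔ IsDegenerateAt N Q := by
  constructor
  · intro h
    by_contra hdeg
    let φ := algebraMap R Q.ResidueField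
    have hker : ∀ x, φ x = 0 ↔ x ∈ Q := fun x => Ideal.algebraMap_residueField_eq_zero
    obtain ⟨f, hf, hdet⟩ := exists_submatrix_det_ne_zero (N.map φ) (fun v hv => by
      by_contra hv0
      obtain ⟨j, hj⟩ := Function.ne_iff.1 hv0
      obtain ⟨b, hb⟩ := IsLocalization.exist_integer_multiples_of_finite
        (nonZeroDivisors (R ⧸ Q)) v
      choose w hw using hb
      choose u hu using fun j => Ideal.Quotient.mk_surjective (w j)
      have hb0 : algebraMap (R ⧸ Q) Q.ResidueField b ≠ 0 := by
        simp
      have hφ : ∀ j, φ (u j) = algebraMap (R ⧸ Q) Q.ResidueField b * v j := fun j => by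
        rw [← Algebra.smul_def]
        refine Eq.trans ?_ (hw j)
        rw [← hu j]
        exact IsScalarTower.algebraMap_apply R (R ⧸ Q) Q.ResidueField (u j)
      refine hdeg ⟨u, ⟨j, fun h0 => ?_⟩, fun i => ?_⟩
      · rw [← hker, hφ] at h0
        exact (mul_ne_zero hb0 hj) h0
      · have hi := congrFun hv i
        simp only [Matrix.mulVec, dotProduct, Matrix.map_apply, Pi.zero_apply] at hi
        rw [← hker, map_sum]
        simp only [map_mul, hφ]
        rw [← mul_zero (algebraMap (R ⧸ Q) Q.ResidueField b), ← hi, Finset.mul_sum]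
        exact Finset.sum_congr rfl fun j _ => by ring)
    refine hdet ?_
    rw [Matrix.submatrix_map, ← RingHom.mapMatrix_apply, ← RingHom.map_det, hker]
    exact h (Ideal.subset_span ⟨f, hf, rfl⟩)
  · rintro ⟨v, ⟨j, hj⟩, hv⟩
    refine Ideal.span_le.2 ?_
    rintro _ ⟨f, -, rfl⟩
    set A := N.submatrix f id
    have hA : ∀ i, A.mulVec v i ∈ Q := fun i => hv (f i)
    have hdet : A.det * v j ∈ Q := by
      have h1 : (A.adjugate * A).mulVec v j = A.det * v j := by
        rw [Matrix.adjugate_mul, Matrix.smul_mulVec, Matrix.one_mulVec]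
        rfl
      rw [← h1, ← Matrix.mulVec_mulVec]
      change ∑ i, A.adjugate j i * A.mulVec v i ∈ Q
      exact Q.sum_mem fun i _ => Q.mul_mem_left _ (hA i)
    exact (Ideal.IsPrime.mem_or_mem ‹_› hdet).resolve_right hj

theorem IsDegenerateAt.mono {R : Type*} [CommRing R] {p q : ℕ} {N : Matrix (Fin p) (Fin q) R}
    {P Q : Ideal R} [P.IsPrime] [Q.IsPrime] (h : IsDegenerateAt N P) (hPQ : P ≤ Q) :
    IsDegenerateAt N Q :=
  (maxMinorsIdeal_le_iff_isDegenerateAt N Q).1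
    (((maxMinorsIdeal_le_iff_isDegenerateAt N P).2 h).trans hPQ)

/-- The matrix obtained by clearing the column `j₀` with the entry `(i₀, j₀)`, without dividing
by that entry. -/
def pivotComplement {R : Type*} [CommRing R] {p q : ℕ} (N : Matrix (Fin (p + 1)) (Fin (q + 1)) R)
    (i₀ : Fin (p + 1)) (j₀ : Fin (q + 1)) : Matrix (Fin p) (Fin q) R :=
  .of fun i j => N i₀ j₀ * N (i₀.succAbove i) (j₀.succAbove j) -
    N (i₀.succAbove i) j₀ * N i₀ (j₀.succAbove j)

theorem isDegenerateAt_pivotComplement_iff {R : Type*} [CommRing R] {p q : ℕ}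
    (N : Matrix (Fin (p + 1)) (Fin (q + 1)) R) (i₀ : Fin (p + 1)) (j₀ : Fin (q + 1))
    (Q : Ideal R) [Q.IsPrime] (hu : N i₀ j₀ ∉ Q) :
    IsDegenerateAt (pivotComplement N i₀ j₀) Q ↔ IsDegenerateAt N Q := by
  have key : ∀ (v : Fin q → R) (i : Fin p), ∑ j, pivotComplement N i₀ j₀ i j * v j =
      N i₀ j₀ * ∑ j, N (i₀.succAbove i) (j₀.succAbove j) * v j -
        N (i₀.succAbove i) j₀ * ∑ j, N i₀ (j₀.succAbove j) * v j := fun v i => by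
    rw [Finset.mul_sum, Finset.mul_sum, ← Finset.sum_sub_distrib]
    exact Finset.sum_congr rfl fun j _ => by simp only [pivotComplement, Matrix.of_apply]; ring
  constructor
  · rintro ⟨v, ⟨j, hj⟩, hv⟩
    refine ⟨j₀.insertNth (-∑ j, N i₀ (j₀.succAbove j) * v j) fun j => N i₀ j₀ * v j,
      ⟨j₀.succAbove j, ?_⟩, fun i => ?_⟩
    · rw [Fin.insertNth_apply_succAbove]
      exact fun h => (Ideal.IsPrime.mem_or_mem ‹_› h).elim hu hj
    · simp only [Fin.sum_univ_succAbove _ j₀, Fin.insertNth_apply_same,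
        Fin.insertNth_apply_succAbove, mul_left_comm _ (N i₀ j₀), ← Finset.mul_sum]
      rcases Fin.eq_self_or_eq_succAbove i₀ i with rfl | ⟨i, rfl⟩
      · convert Q.zero_mem using 1
        ring
      · convert hv i using 1
        rw [key]
        ring
  · rintro ⟨v, ⟨j, hj⟩, hv⟩
    simp only [Fin.sum_univ_succAbove _ j₀] at hv
    refine ⟨fun j => v (j₀.succAbove j), ?_, fun i => ?_⟩
    · by_contra! hall
      have h0 : v j₀ ∈ Q := by
        have h1 := (Ideal.add_mem_iff_left _ (Q.sum_mem fun j _ =>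
          Q.mul_mem_left (N i₀ (j₀.succAbove j)) (hall j))).1 (hv i₀)
        exact (Ideal.IsPrime.mem_or_mem ‹_› h1).resolve_left hu
      rcases Fin.eq_self_or_eq_succAbove j₀ j with rfl | ⟨j, rfl⟩
      · exact hj h0
      · exact hj (hall j)
    · rw [key]
      convert Q.sub_mem (Q.mul_mem_left (N i₀ j₀) (hv (i₀.succAbove i)))
        (Q.mul_mem_left (N (i₀.succAbove i) j₀) (hv i₀)) using 1
      ring

theorem height_le_height_map_C {R : Type*} [CommRing R] (P : Ideal R) [P.IsPrime] :
    P.height ≤ (P.map (Polynomial.C : R →+* Polynomial R)).height := by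
  let f : PrimeSpectrum R → PrimeSpectrum (Polynomial R) := fun p =>
    ⟨p.asIdeal.map Polynomial.C, Ideal.isPrime_map_C_of_isPrime⟩
  have hf : StrictMono f := by
    refine Monotone.strictMono_of_injective (fun p q h => Ideal.map_mono h) fun p q h => ?_
    ext x
    have hx : Polynomial.C x ∈ (f p).asIdeal ↔ Polynomial.C x ∈ (f q).asIdeal := by rw [h]
    have hC : ∀ I : Ideal R, Polynomial.C x ∈ I.map Polynomial.C ↔ x ∈ I := fun I =>
      ⟨fun h => by simpa using Ideal.mem_map_C_iff.1 h 0, Ideal.mem_map_of_mem _⟩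
    rwa [hC, hC] at hx
  have := Order.height_le_height_apply_of_strictMono f hf ⟨P, ‹_›⟩
  rwa [← PrimeSpectrum.height_eq_orderHeight, ← PrimeSpectrum.height_eq_orderHeight] at this

open Polynomial in
/-- If `(P, X)` is minimal over `Q + (X)`, then no prime lies strictly between `Q` and `(P, X)`;
in particular `P R[X]` does not. -/
theorem map_C_le_of_mem_minimalPrimes {R : Type*} [CommRing R] [IsNoetherianRing R]
    (P : Ideal R) [P.IsPrime] (Q : Ideal R[X]) [Q.IsPrime] (hQ : Q ≤ P.map C)
    (hmin : P.comap constantCoeff ∈ (Q ⊔ Ideal.span {X}).minimalPrimes) : P.map C ≤ Q := by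
  have hht := Ideal.map_height_le_one_of_mem_minimalPrimes hmin
  have hPT : P.map C < P.comap constantCoeff := by
    refine lt_of_le_of_ne (Ideal.map_le_iff_le_comap.2 fun x hx => by simpa using hx) fun h => ?_
    have hX : (X : R[X]) ∈ P.map C := by
      rw [h]
      simp
    have h1 := Ideal.mem_map_C_iff.1 hX 1
    rw [coeff_X_one] at h1
    exact Ideal.IsPrime.ne_top ‹_› ((Ideal.eq_top_iff_one P).2 h1)
  by_contra hne
  have hQP : Q < P.map C := lt_of_le_not_ge hQ hne
  let π := Ideal.Quotient.mk Q
  have hπ : Function.Surjective π := Ideal.Quotient.mk_surjective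
  have hcomap : ∀ J : Ideal R[X], Q ≤ J → (J.map π).comap π = J := fun J hJ => by
    rw [Ideal.comap_map_of_surjective π hπ, sup_eq_left, ← RingHom.ker_eq_comap_bot,
      Ideal.mk_ker]
    exact hJ
  have hprime : ∀ J : Ideal R[X], J.IsPrime → Q ≤ J → (J.map π).IsPrime := fun J _ hJ =>
    Ideal.map_isPrime_of_surjective hπ (by rwa [Ideal.mk_ker])
  have hlt : ∀ I J : Ideal R[X], Q ≤ I → I < J → I.map π < J.map π := fun I J hI hIJ => by
    refine lt_of_le_not_ge (Ideal.map_mono hIJ.le) fun h => hIJ.not_ge ?_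
    have := Ideal.comap_mono (f := π) h
    rwa [hcomap I hI, hcomap J (hI.trans hIJ.le)] at this
  have i1 := hprime Q ‹_› le_rfl
  have i2 := hprime (P.map C) inferInstance hQ
  have i3 := hprime (P.comap constantCoeff) inferInstance (hQ.trans hPT.le)
  have h1 := Ideal.height_add_one_le_of_lt_of_isPrime (hlt _ _ le_rfl hQP)
  have h2 := Ideal.height_add_one_le_of_lt_of_isPrime (hlt _ _ hQ hPT)
  have h3 : (1 : ℕ∞) + 1 ≤ 1 :=
    (add_le_add_left (le_add_self.trans h1) 1).trans (h2.trans hht)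
  exact absurd h3 (by decide)

open Polynomial in
theorem isDegenerateAt_map_C_and_minimal {R : Type*} [CommRing R] [IsNoetherianRing R] {p q : ℕ}
    (N : Matrix (Fin (p + 1)) (Fin (q + 2)) R) (P : Ideal R) [P.IsPrime]
    (hP : ∀ i j, N i j ∈ P)
    (hmin : ∀ Q : Ideal R, Q.IsPrime → Q ≤ P → IsDegenerateAt N Q → P ≤ Q) :
    IsDegenerateAt (N.map C + Matrix.single 0 0 X) (P.map C) ∧
      ∀ Q : Ideal R[X], Q.IsPrime → Q ≤ P.map C →
        IsDegenerateAt (N.map C + Matrix.single 0 0 X) Q → P.map C ≤ Q := by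
  refine ⟨⟨Pi.single 1 1, ⟨1, ?_⟩, fun i => ?_⟩, fun Q hQp hQ hdeg => ?_⟩
  · rw [Pi.single_eq_same, ← Ideal.eq_top_iff_one]
    exact Ideal.IsPrime.ne_top inferInstance
  · refine Ideal.sum_mem _ fun j _ => ?_
    rcases eq_or_ne j 1 with rfl | hj
    · simpa using Ideal.mem_map_of_mem C (hP i 1)
    · simp [Pi.single_eq_of_ne hj]
  · refine map_C_le_of_mem_minimalPrimes P Q hQ ⟨⟨inferInstance, sup_le ?_ ?_⟩, ?_⟩
    · exact hQ.trans (Ideal.map_le_iff_le_comap.2 fun x hx => by simpa using hx)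
    · simp
    · rintro T ⟨hTp, hT⟩ hTP
      have hX : X ∈ T := hT (Ideal.mem_sup_right (Ideal.mem_span_singleton_self _))
      have hmem : ∀ f : R[X], f ∈ T ↔ f.coeff 0 ∈ T.comap C := fun f => by
        rw [Ideal.mem_comap]
        conv_lhs => rw [← divX_mul_X_add f]
        exact Ideal.add_mem_iff_right _ (T.mul_mem_left _ hX)
      have hdegT : IsDegenerateAt (N.map C + Matrix.single 0 0 X) T :=
        hdeg.mono (le_sup_left.trans hT)
      have hPT : P ≤ T.comap C := by
        refine hmin _ inferInstance (fun x hx => by simpa using hTP hx) ?_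
        obtain ⟨v, ⟨j, hj⟩, hv⟩ := hdegT
        refine ⟨fun j => (v j).coeff 0, ⟨j, fun h => hj ((hmem _).2 h)⟩, fun i => ?_⟩
        have hi := (hmem _).1 (hv i)
        rw [finsetSum_coeff] at hi
        convert hi using 1
        refine Finset.sum_congr rfl fun j _ => ?_
        simp only [mul_coeff_zero, Matrix.add_apply, Matrix.map_apply, coeff_add, coeff_C_zero,
          Matrix.single_apply]
        split_ifs <;> simp
      intro f hf
      exact (hmem f).2 (hPT (by simpa using hf))

theorem height_le_of_pivot {R : Type*} [CommRing R] {p q : ℕ}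
    (ih : ∀ (p : ℕ) (N : Matrix (Fin p) (Fin q) R) (P : Ideal R) [P.IsPrime],
      IsDegenerateAt N P →
      (∀ Q : Ideal R, Q.IsPrime → Q ≤ P → IsDegenerateAt N Q → P ≤ Q) →
      P.height ≤ (p + 1 - q : ℕ))
    (N : Matrix (Fin (p + 1)) (Fin (q + 1)) R) (P : Ideal R) [P.IsPrime]
    (hdeg : IsDegenerateAt N P)
    (hmin : ∀ Q : Ideal R, Q.IsPrime → Q ≤ P → IsDegenerateAt N Q → P ≤ Q)
    (i₀ : Fin (p + 1)) (j₀ : Fin (q + 1)) (hu : N i₀ j₀ ∉ P) :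
    P.height ≤ (p + 1 + 1 - (q + 1) : ℕ) := by
  rw [Nat.add_sub_add_right]
  exact ih p (pivotComplement N i₀ j₀) P
    ((isDegenerateAt_pivotComplement_iff N i₀ j₀ P hu).2 hdeg) fun Q hQp hQ hd =>
      hmin Q hQp hQ ((isDegenerateAt_pivotComplement_iff N i₀ j₀ Q fun h => hu (hQ h)).1 hd)

/-- The Eagon–Northcott bound: a minimal prime of the degeneracy locus of a `p × q` matrix over a
Noetherian ring has height at most `p - q + 1`. -/
theorem height_le_of_minimal_isDegenerateAt (q : ℕ) :
    ∀ {R : Type*} [CommRing R] [IsNoetherianRing R] (p : ℕ) (N : Matrix (Fin p) (Fin q) R)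
      (P : Ideal R) [P.IsPrime], IsDegenerateAt N P →
      (∀ Q : Ideal R, Q.IsPrime → Q ≤ P → IsDegenerateAt N Q → P ≤ Q) →
      P.height ≤ (p + 1 - q : ℕ) := by
  induction q with
  | zero =>
    rintro R _ _ p N P _ ⟨v, ⟨j, -⟩, -⟩ -
    exact j.elim0
  | succ q ih =>
    intro R _ _ p N P _ hdeg hmin
    by_cases hpiv : ∃ i j, N i j ∉ P
    · obtain ⟨i₀, j₀, hu⟩ := hpiv
      obtain ⟨p, rfl⟩ : ∃ p', p = p' + 1 := ⟨p - 1, by have := i₀.2; omega⟩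
      exact height_le_of_pivot (fun p N P => ih p N P) N P hdeg hmin i₀ j₀ hu
    · push Not at hpiv
      by_cases hq : p = 0 ∨ q = 0
      · have hcard : (Set.range fun ij : Fin p × Fin (q + 1) => N ij.1 ij.2).ncard ≤
            p + 1 - (q + 1) := by
          rw [← Set.image_univ]
          refine (Set.ncard_image_le Set.finite_univ).trans ?_
          rcases hq with rfl | rfl <;> simp
        refine (Ideal.height_le_card_of_mem_minimalPrimes_span (Set.finite_range
          fun ij : Fin p × Fin (q + 1) => N ij.1 ij.2) ⟨⟨‹_›, ?_⟩, ?_⟩).trans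
            (by exact_mod_cast hcard)
        · exact Ideal.span_le.2 (by rintro _ ⟨ij, rfl⟩; exact hpiv _ _)
        · rintro Q ⟨hQp, hQ⟩ hQP
          refine hmin Q hQp hQP ⟨Pi.single 0 1, ⟨0, ?_⟩, fun i => ?_⟩
          · rw [Pi.single_eq_same, ← Ideal.eq_top_iff_one]
            exact hQp.ne_top
          · exact Ideal.sum_mem _ fun j _ => Q.mul_mem_right _
              (hQ (Ideal.subset_span ⟨(i, j), rfl⟩))
      · push Not at hq
        obtain ⟨p, rfl⟩ := Nat.exists_eq_succ_of_ne_zero hq.1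
        obtain ⟨q, rfl⟩ := Nat.exists_eq_succ_of_ne_zero hq.2
        obtain ⟨hd, hm⟩ := isDegenerateAt_map_C_and_minimal N P hpiv hmin
        refine (height_le_height_map_C P).trans
          (height_le_of_pivot (fun p N P => ih p N P) _ _ hd hm 0 0 fun h => ?_)
        have h1 := Ideal.mem_map_C_iff.1 h 1
        simp [Polynomial.coeff_C_succ, ← Ideal.eq_top_iff_one, Ideal.IsPrime.ne_top ‹_›] at h1

theorem exists_isDegenerateAt_and_height_le {R : Type*} [CommRing R] [IsNoetherianRing R] {p q : ℕ}
    (N : Matrix (Fin p) (Fin q) R) (m : Ideal R) [m.IsPrime] (hm : IsDegenerateAt N m) :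
    ∃ P : PrimeSpectrum R, IsDegenerateAt N P.asIdeal ∧ Order.height P ≤ (p + 1 - q : ℕ) := by
  obtain ⟨P, hP, hPm⟩ := Ideal.exists_minimalPrimes_le
    ((maxMinorsIdeal_le_iff_isDegenerateAt N m).2 hm)
  have hPp : P.IsPrime := hP.1.1
  have hdeg := (maxMinorsIdeal_le_iff_isDegenerateAt N P).1 hP.1.2
  refine ⟨⟨P, hPp⟩, hdeg, ?_⟩
  rw [← PrimeSpectrum.height_eq_orderHeight]
  exact height_le_of_minimal_isDegenerateAt q p N P hdeg fun Q hQp hQ hd =>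
    hP.2 ⟨hQp, (maxMinorsIdeal_le_iff_isDegenerateAt N Q).2 hd⟩ hQ

theorem le_height_of_X_mem {k : Type*} [Field k] (n : ℕ)
    (P : PrimeSpectrum (MvPolynomial (Fin n) k)) (hP : ∀ t, MvPolynomial.X t ∈ P.asIdeal) :
    (n : ℕ∞) ≤ Order.height P := by
  classical
  let ψ : ℕ → MvPolynomial (Fin n) k →ₐ[k] MvPolynomial (Fin n) k := fun i =>
    MvPolynomial.aeval fun t => if t.val < i then 0 else MvPolynomial.X t
  have hψX : ∀ i t, ψ i (MvPolynomial.X t) = if t.val < i then 0 else MvPolynomial.X t :=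
    fun i t => MvPolynomial.aeval_X _ _
  let c : Fin (n + 1) → PrimeSpectrum (MvPolynomial (Fin n) k) := fun i =>
    ⟨RingHom.ker (ψ i), RingHom.ker_isPrime _⟩
  have hle : ∀ i j : ℕ, i ≤ j → RingHom.ker (ψ i) ≤ RingHom.ker (ψ j) := fun i j hij f hf => by
    have hcomp : (ψ j).comp (ψ i) = ψ j := by
      ext1 t
      rw [AlgHom.comp_apply, hψX]
      split_ifs with h
      · rw [map_zero, hψX, if_pos (h.trans_le hij)]
      · rfl
    rw [RingHom.mem_ker] at hf ⊢
    rw [← hcomp, AlgHom.comp_apply, hf, map_zero]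
  have hc : StrictMono c := by
    refine Fin.strictMono_iff_lt_succ.2 fun i => lt_of_le_not_ge (hle _ _ (by simp)) fun h => ?_
    have h1 : MvPolynomial.X i ∈ RingHom.ker (ψ i.succ) := by
      rw [RingHom.mem_ker, hψX, if_pos (by simp)]
    have h2 : ψ i (MvPolynomial.X i) = 0 := h h1
    rw [hψX, if_neg (lt_irrefl _)] at h2
    exact MvPolynomial.X_ne_zero i h2
  have hlast : (LTSeries.mk n c hc).last ≤ P := fun f hf => by
    have hconst : ψ n f = MvPolynomial.C (MvPolynomial.constantCoeff f) := by
      have : ψ n = MvPolynomial.aeval fun _ => 0 := by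
        ext1 t
        rw [hψX, if_pos t.2, MvPolynomial.aeval_X]
      rw [this, MvPolynomial.aeval_zero']
      rfl
    have hf0 : MvPolynomial.constantCoeff f = 0 := by
      have : ψ n f = 0 := hf
      rw [hconst] at this
      simpa using this
    have hmem : f ∈ Ideal.span (Set.range (MvPolynomial.X (R := k) (σ := Fin n))) := by
      rw [← Set.image_univ, MvPolynomial.mem_ideal_span_X_image]
      intro m hm
      by_contra! hall
      have : m = 0 := Finsupp.ext fun t => by simpa using hall t (Set.mem_univ t)
      subst this
      exact MvPolynomial.mem_support_iff.1 hm hf0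
    exact Ideal.span_le.2 (by rintro _ ⟨t, rfl⟩; exact hP t) hmem
  exact Order.length_le_height hlast

/-- The band matrix whose `t`-th subdiagonal consists of powers of `x_t`. -/
noncomputable def bandMatrix (k : Type*) [Field k] (n : ℕ) {p q : ℕ} (e : Fin p → Fin q → ℕ) :
    Matrix (Fin p) (Fin q) (MvPolynomial (Fin (n + 1)) k) :=
  .of fun j i => if h : i.val ≤ j.val ∧ j.val ≤ n + i.val then
    MvPolynomial.X ⟨j.val - i.val, by omega⟩ ^ e j i else 0

theorem X_mem_of_isDegenerateAt_bandMatrix {k : Type*} [Field k] {n p q : ℕ}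
    (hpq : n + q ≤ p) (e : Fin p → Fin q → ℕ)
    (he : ∀ j i, j.val ≤ n + i.val → e j i ≠ 0)
    (P : Ideal (MvPolynomial (Fin (n + 1)) k)) [P.IsPrime]
    (hP : IsDegenerateAt (bandMatrix k n e) P) (t : Fin (n + 1)) : MvPolynomial.X t ∈ P := by
  classical
  obtain ⟨v, hne, hv⟩ := hP
  obtain ⟨i₀, hi₀, hfirst⟩ : ∃ i, v i ∉ P ∧ ∀ i' < i, v i' ∈ P := by
    obtain ⟨i, hi, hm⟩ := WellFounded.has_min (wellFounded_lt (α := Fin q)) {i | v i ∉ P} hne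
    exact ⟨i, hi, fun i' hi' => by by_contra h; exact hm i' h hi'⟩
  obtain ⟨t, ht⟩ := t
  induction t using Nat.strong_induction_on with
  | _ t ih =>
    let j : Fin p := ⟨i₀.val + t, by omega⟩
    have hj := hv j
    rw [← Finset.add_sum_erase _ _ (Finset.mem_univ i₀), Ideal.add_mem_iff_left] at hj
    · have hX : bandMatrix k n e j i₀ = MvPolynomial.X ⟨t, ht⟩ ^ e j i₀ := by
        simp only [bandMatrix, Matrix.of_apply, j]
        rw [dif_pos (by omega)]
        congr 3
        omega
      rw [hX] at hj
      exact Ideal.IsPrime.mem_of_pow_mem ‹_› _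
        ((Ideal.IsPrime.mem_or_mem ‹_› hj).resolve_right hi₀)
    · refine P.sum_mem fun i hi => ?_
      rcases lt_or_gt_of_ne (Finset.ne_of_mem_erase hi) with hlt | hgt
      · exact P.mul_mem_left _ (hfirst i hlt)
      · refine P.mul_mem_right _ ?_
        simp only [bandMatrix, Matrix.of_apply]
        split_ifs with h
        · have hgt' : i₀.val < i.val := hgt
          simp only [j] at h
          exact P.pow_mem_of_mem (ih _ (by simp only [j]; omega) (by simp only [j]; omega)) _
            (Nat.pos_of_ne_zero (he _ _ h.2))
        · exact P.zero_mem

theorem isDegenerateAt_of_forall_mem {R : Type*} [CommRing R] {p q : ℕ}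
    {N : Matrix (Fin p) (Fin q) R} {m : Ideal R} [m.IsPrime] (hq : 1 ≤ q)
    (h : ∀ i j, N i j ∈ m) : IsDegenerateAt N m :=
  ⟨fun _ => 1, ⟨⟨0, hq⟩, fun h1 => Ideal.IsPrime.ne_top ‹_› ((Ideal.eq_top_iff_one m).2 h1)⟩,
    fun i => m.sum_mem fun j _ => m.mul_mem_right _ (h i j)⟩

theorem IsDegenerateAt.of_submatrix_castLE {R : Type*} [CommRing R] {p q p' q' : ℕ}
    {N : Matrix (Fin p) (Fin q) R} {Q : Ideal R} (hp : p' ≤ p) (hq : q' ≤ q)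
    (hzero : ∀ (j : Fin p) (i : Fin q), p' ≤ j.val → i.val < q' → N j i = 0)
    (h : IsDegenerateAt (N.submatrix (Fin.castLE hp) (Fin.castLE hq)) Q) :
    IsDegenerateAt N Q := by
  obtain ⟨v, ⟨i, hi⟩, hv⟩ := h
  obtain ⟨d, rfl⟩ := Nat.exists_eq_add_of_le hq
  refine ⟨Fin.append v 0, ⟨Fin.castAdd d i, by rwa [Fin.append_left]⟩, fun j => ?_⟩
  simp only [Fin.sum_univ_add, Fin.append_left, Fin.append_right, Pi.zero_apply, mul_zero,
    Finset.sum_const_zero, add_zero]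
  rcases lt_or_ge j.val p' with hj | hj
  · exact hv ⟨j.val, hj⟩
  · refine Q.sum_mem fun i _ => ?_
    rw [hzero j _ hj i.2, zero_mul]
    exact Q.zero_mem

theorem idealHeight_maxMinorsIdeal_le_of_zero_block {R : Type*} [CommRing R] [IsNoetherianRing R]
    {p q p' q' : ℕ} (N : Matrix (Fin p) (Fin q) R) (m : Ideal R) [m.IsPrime]
    (hN : ∀ j i, N j i ∈ m) (hp : p' ≤ p) (hq : q' ≤ q) (hq' : 1 ≤ q')
    (hzero : ∀ (j : Fin p) (i : Fin q), p' ≤ j.val → i.val < q' → N j i = 0) :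
    idealHeight (maxMinorsIdeal N) ≤ (p' + 1 - q' : ℕ) := by
  obtain ⟨P, hP, hht⟩ := exists_isDegenerateAt_and_height_le
    (N.submatrix (Fin.castLE hp) (Fin.castLE hq)) m
    (isDegenerateAt_of_forall_mem hq' fun i j => hN _ _)
  exact (iInf₂_le P ((maxMinorsIdeal_le_iff_isDegenerateAt N P.asIdeal).2
    (hP.of_submatrix_castLE hp hq hzero))).trans hht

/-- **Theorem 1.2** (classification of Betti numbers, matrix form): over
`R = k[x_0,…,x_n]` with `k` algebraically closed, given weakly increasing integer
sequences `a_1 ≤ … ≤ a_l` (`l ≥ 1`) and `b_1 ≤ … ≤ b_{l+r}` (`r ≥ 1`), there exists an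
`(l+r) × l` matrix `M` whose `(j,i)` entry is homogeneous of degree `a_i − b_j` and zero
whenever `a_i ≤ b_j`, with `ht I_l(M) ≥ n + 1`, if and only if `r ≥ n` and
`a_i > b_{n+i}` for all `i`. -/
theorem exists_minimal_matrix_iff_admissible
    (k : Type) [Field k] [IsAlgClosed k] (n : ℕ) (hn : 1 ≤ n)
    (l r : ℕ) (hl : 1 ≤ l) (hr : 1 ≤ r)
    (a : Fin l → ℤ) (ha : Monotone a) (b : Fin (l + r) → ℤ) (hb : Monotone b) :
    (∃ M : Matrix (Fin (l + r)) (Fin l) (MvPolynomial (Fin (n + 1)) k),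
      (∀ (j : Fin (l + r)) (i : Fin l),
        (b j < a i → (M j i).IsHomogeneous (a i - b j).toNat) ∧
        (a i ≤ b j → M j i = 0)) ∧
      (n : ℕ∞) + 1 ≤ idealHeight (maxMinorsIdeal M)) ↔
      (n ≤ r ∧ ∀ (i : Fin l) (h : n + i.val < l + r), b ⟨n + i.val, h⟩ < a i) := by
  constructor
  · rintro ⟨M, hM, hht⟩
    let m : Ideal (MvPolynomial (Fin (n + 1)) k) := RingHom.ker MvPolynomial.constantCoeff
    have hm : m.IsPrime := RingHom.ker_isPrime _
    have hMm : ∀ j i, M j i ∈ m := fun j i => by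
      rcases lt_or_ge (b j) (a i) with h | h
      · rw [RingHom.mem_ker, MvPolynomial.constantCoeff_eq]
        refine ((hM j i).1 h).coeff_eq_zero ?_
        rw [map_zero]
        omega
      · rw [(hM j i).2 h]
        exact m.zero_mem
    refine ⟨?_, fun i h => ?_⟩
    · have h1 := hht.trans (idealHeight_maxMinorsIdeal_le_of_zero_block M m hMm le_rfl le_rfl hl
        fun j _ hj => absurd j.2 (by omega))
      have h2 : n + 1 ≤ l + r + 1 - l := by exact_mod_cast h1
      omega
    · by_contra! hab
      have h1 := hht.trans (idealHeight_maxMinorsIdeal_le_of_zero_block M m hMm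
        (p' := n + i.val) (q' := i.val + 1) h.le i.2 (by omega) fun j i' hj hi' =>
          (hM j i').2 ((ha (show i' ≤ i from by rw [Fin.le_def]; omega)).trans
            (hab.trans (hb hj))))
      have h2 : n + 1 ≤ n + i.val + 1 - (i.val + 1) := by exact_mod_cast h1
      omega
  · rintro ⟨hnr, hab⟩
    have hlt : ∀ (j : Fin (l + r)) (i : Fin l), j.val ≤ n + i.val → b j < a i := fun j i hj =>
      (hb (show j ≤ ⟨n + i.val, by omega⟩ from hj)).trans_lt (hab i _)
    refine ⟨bandMatrix k n fun j i => (a i - b j).toNat, fun j i => ⟨fun _ => ?_, fun h => ?_⟩, ?_⟩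
    · simp only [bandMatrix, Matrix.of_apply]
      split_ifs
      · exact MvPolynomial.isHomogeneous_X_pow _ _
      · exact MvPolynomial.isHomogeneous_zero _ _ _
    · simp only [bandMatrix, Matrix.of_apply]
      exact dif_neg fun hij => (hlt j i hij.2).not_ge h
    · refine le_iInf₂ fun P hP => ?_
      rw [maxMinorsIdeal_le_iff_isDegenerateAt] at hP
      exact_mod_cast le_height_of_X_mem (n + 1) P
        (X_mem_of_isDegenerateAt_bandMatrix (by omega) _
          (fun j i hj => by have := hlt j i hj; omega) P.asIdeal hP)
end

section
/- Let k be a field, n ≥ 1, and let a_1 ≤ … ≤ a_l (l ≥ 1) and b_1 ≤ … ≤ b_{l+r} be weakly increasing integer sequences with r ≥ n and a_i > b_{n+i} for all i = 1,…,l. Define the (l+r)×l matrix T over k[x_0,…,x_n] by T_{j,i} = x_{j−i}^{a_i − b_j} whenever 0 ≤ j−i ≤ n, and T_{j,i} = 0 otherwise (rows j = 1,…,l+r; columns i = 1,…,l; all occurring exponents a_i − b_j are positive since a_i > b_{i+n} ≥ b_j for i ≤ j ≤ i+n). Then for every nonzero point p ∈ k^{n+1}, the matrix T(p) obtained by evaluating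 all entries at p has rank l. -/
/-- **The explicit construction in the proof of Theorem 1.2**: for an admissible pair
(`r ≥ n`, `a_i > b_{n+i}`), the matrix `T` with `T_{j,i} = x_{j−i}^{a_i − b_j}` for
`0 ≤ j − i ≤ n` and `T_{j,i} = 0` otherwise drops rank nowhere: evaluating its entries
at any nonzero point `p ∈ k^{n+1}` yields a matrix of full column rank `l`. -/
theorem rank_explicit_matrix_eq (k : Type) [Field k] (n : ℕ) (hn : 1 ≤ n)
    (l r : ℕ) (hl : 1 ≤ l) (hnr : n ≤ r)
    (a : Fin l → ℤ) (ha : Monotone a) (b : Fin (l + r) → ℤ) (hb : Monotone b)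
    (hadm : ∀ (i : Fin l) (h : n + i.val < l + r), b ⟨n + i.val, h⟩ < a i)
    (p : Fin (n + 1) → k) (hp : p ≠ 0)
    (T : Matrix (Fin (l + r)) (Fin l) k)
    (hT : ∀ (j : Fin (l + r)) (i : Fin l),
      T j i = if h : i.val ≤ j.val ∧ j.val - i.val ≤ n then
          (p ⟨j.val - i.val, Nat.lt_succ_of_le h.2⟩) ^ (a i - b j).toNat
        else 0) :
    T.rank = l := by
  have hexp : ∀ (j : Fin (l + r)) (i : Fin l), j.val - i.val ≤ n → (a i - b j).toNat ≠ 0 := by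
    intro j i h
    have hlt : n + i.val < l + r := by omega
    have hle : b j ≤ b ⟨n + i.val, hlt⟩ := hb (by rw [Fin.le_def]; dsimp only; omega)
    have := hadm i hlt
    omega
  obtain ⟨s, hs, hmin⟩ : ∃ s, p s ≠ 0 ∧ ∀ t < s, p t = 0 := by
    obtain ⟨s, hs⟩ := WellFounded.has_min (wellFounded_lt (α := Fin (n + 1))) {s | p s ≠ 0}
      (Function.ne_iff.mp hp)
    exact ⟨s, hs.1, fun t ht => by_contra fun h => hs.2 t h ht⟩
  let f : Fin l → Fin (l + r) := fun i => ⟨i.val + s.val, by omega⟩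
  have htri : (T.submatrix f id).IsLowerTriangular := by
    intro i i' hii
    have hlt : i < i' := hii
    rw [Fin.lt_def] at hlt
    simp only [Matrix.submatrix_apply, id_eq, hT]
    split_ifs with h
    · rw [hmin, zero_pow (hexp _ _ h.2)]
      rw [Fin.lt_def]
      simp only [f] at h ⊢
      omega
    · rfl
  have hdiag : ∀ i, T.submatrix f id i i ≠ 0 := by
    intro i
    have hfi : (f i).val - i.val = s.val := by simp [f]
    have hle : i.val ≤ (f i).val := by simp [f]
    simp only [Matrix.submatrix_apply, id_eq, hT, hfi]
    rw [dif_pos ⟨hle, Nat.le_of_lt_succ s.isLt⟩]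
    exact pow_ne_zero _ hs
  have hdet : IsUnit (T.submatrix f id) := by
    rw [Matrix.isUnit_iff_isUnit_det, isUnit_iff_ne_zero, Matrix.det_of_isLowerTriangular _ htri]
    exact Finset.prod_ne_zero_iff.mpr fun i _ => hdiag i
  apply le_antisymm
  · simpa using T.rank_le_width
  · simpa [Matrix.rank_of_isUnit _ hdet] using Matrix.rank_submatrix_le T f id
end
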